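/- Let R ⊆ ℕ be either a singleton {d} for some d ∈ ℕ, or of the form dS for some positive integer d and some cofinite set S ⊆ ℕ. Then there exist a finite alphabet A and an irreducible (topologically transitive) one-step shift of finite type X over A with LPS(X) = R. Moreover, if R = {1} or R is cofinite, then X can be taken to be topologically mixing. -/

import Mathlib

/-- The shift map on the full shift `A^ℤ`: `(σ x) i = x (i+1)`. -/
def shiftMap {A : Type*} : (ℤ → A) → (ℤ → A) := fun x i => x (i + 1)

/-- A one-step shift of finite type: the set of bi-infinite sequences all of whose
adjacent pairs lie in a relation `R ⊆ A × A`. -/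
def IsOneStepSFT {A : Type*} (X : Set (ℤ → A)) : Prop :=
  ∃ R : Set (A × A), X = {x | ∀ i : ℤ, (x i, x (i + 1)) ∈ R}

/-- Topological transitivity of the shift restricted to a subset `X` of the full shift:
for all open `U, V` meeting `X` there is `n > 0` and a point of `X` in `U` whose
`n`-th shift lies in `V`. -/
def TransitiveOn {A : Type*} [TopologicalSpace A] (X : Set (ℤ → A)) : Prop :=
  ∀ U V : Set (ℤ → A), IsOpen U → IsOpen V → (U ∩ X).Nonempty → (V ∩ X).Nonempty →
    ∃ n : ℕ, 0 < n ∧ ∃ x ∈ X, x ∈ U ∧ shiftMap^[n] x ∈ V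

/-- Topological mixing of the shift restricted to a subset `X` of the full shift. -/
def MixingOn {A : Type*} [TopologicalSpace A] (X : Set (ℤ → A)) : Prop :=
  ∀ U V : Set (ℤ → A), IsOpen U → IsOpen V → (U ∩ X).Nonempty → (V ∩ X).Nonempty →
    ∃ N : ℕ, ∀ n : ℕ, N ≤ n → ∃ x ∈ X, x ∈ U ∧ shiftMap^[n] x ∈ V

/-- The least period set of the shift restricted to a subset `X` of the full shift. -/
def LPSset {A : Type*} (X : Set (ℤ → A)) : Set ℕ :=
  {n | 0 < n ∧ ∃ x ∈ X, shiftMap^[n] x = x ∧ ∀ k, 0 < k → k < n → shiftMap^[k] x ≠ x}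

/-- `S` is a cofinite subset of `ℕ = {1, 2, 3, ...}`. -/
def CofinitePos (S : Set ℕ) : Prop :=
  S ⊆ {n : ℕ | 0 < n} ∧ ({n : ℕ | 0 < n} \ S).Finite

/-- The one-step shift of finite type whose allowed transitions are given by `r`. -/
def oneStepShift {A : Type*} (r : A → A → Prop) : Set (ℤ → A) :=
  {x | ∀ i : ℤ, r (x i) (x (i + 1))}

/-- Some point of `X` sees `a` at coordinate `0` and `b` at coordinate `n`. -/
def Connects {A : Type*} (X : Set (ℤ → A)) (n : ℕ) (a b : A) : Prop :=
  ∃ x ∈ X, x 0 = a ∧ x n = b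

theorem iterate_shiftMap_apply {A : Type*} (n : ℕ) (x : ℤ → A) (i : ℤ) :
    shiftMap^[n] x i = x (i + n) := by
  induction n generalizing x i with
  | zero => simp
  | succ n ih =>
    rw [Function.iterate_succ_apply, ih, shiftMap]
    congr 1
    push_cast
    ring

theorem isOneStepSFT_oneStepShift {A : Type*} (r : A → A → Prop) :
    IsOneStepSFT (oneStepShift r) :=
  ⟨{p | r p.1 p.2}, rfl⟩

section Splicing

variable {A : Type*} {r : A → A → Prop}

theorem shift_mem_oneStepShift {x : ℤ → A} (hx : x ∈ oneStepShift r) (k : ℤ) :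
    (fun i => x (i + k)) ∈ oneStepShift r := by
  intro i
  have := hx (i + k)
  rwa [add_right_comm] at this

theorem exists_splice {x y : ℤ → A} (hx : x ∈ oneStepShift r) (hy : y ∈ oneStepShift r)
    {k : ℤ} (h : x k = y k) :
    ∃ z ∈ oneStepShift r, (∀ i ≤ k, z i = x i) ∧ ∀ i, k ≤ i → z i = y i := by
  refine ⟨fun i => if i ≤ k then x i else y i, fun i => ?_, fun i hi => if_pos hi, fun i hi => ?_⟩
  · rcases lt_trichotomy i k with hi | rfl | hi
    · simpa [hi.le, show i + 1 ≤ k by omega] using hx i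
    · simpa [h] using hy i
    · simpa [show ¬ i ≤ k by omega, show ¬ i + 1 ≤ k by omega] using hy i
  · rcases hi.eq_or_lt with rfl | hi
    · simpa using h
    · simp [hi]

theorem Connects.of_mem {x : ℤ → A} (hx : x ∈ oneStepShift r) {a b : A} {i : ℤ} {n : ℕ}
    (ha : x i = a) (hb : x (i + n) = b) : Connects (oneStepShift r) n a b :=
  ⟨fun j => x (j + i), shift_mem_oneStepShift hx i, by simpa using ha,
    by simpa [add_comm] using hb⟩

theorem Connects.trans {m n : ℕ} {a b c : A} (h₁ : Connects (oneStepShift r) m a b)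
    (h₂ : Connects (oneStepShift r) n b c) : Connects (oneStepShift r) (m + n) a c := by
  obtain ⟨x, hx, rfl, hxb⟩ := h₁
  obtain ⟨y, hy, rfl, rfl⟩ := h₂
  obtain ⟨z, hz, hzx, hzy⟩ := exists_splice hx (shift_mem_oneStepShift hy (-m)) (k := m)
    (by simpa using hxb)
  refine ⟨z, hz, hzx 0 (by omega), ?_⟩
  rw [hzy _ (by omega)]
  congr 1
  omega

theorem exists_cylinder_subset [TopologicalSpace A] {U : Set (ℤ → A)} (hU : IsOpen U)
    {x : ℤ → A} (hx : x ∈ U) :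
    ∃ M : ℕ, ∀ y : ℤ → A, (∀ i : ℤ, -M ≤ i → i ≤ M → y i = x i) → y ∈ U := by
  obtain ⟨I, u, hu, hIU⟩ := isOpen_pi_iff.1 hU x hx
  refine ⟨I.sup Int.natAbs, fun y hy => hIU fun i hi => ?_⟩
  have : i.natAbs ≤ I.sup Int.natAbs := Finset.le_sup hi
  rw [hy i (by omega) (by omega)]
  exact (hu i hi).2

/-- Words of `x` and of `y` occur in a common point as soon as a word connects them. -/
theorem exists_gap_of_isOpen [TopologicalSpace A] {U V : Set (ℤ → A)} (hU : IsOpen U)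
    (hV : IsOpen V) (hUX : (U ∩ oneStepShift r).Nonempty) (hVX : (V ∩ oneStepShift r).Nonempty) :
    ∃ (g : ℕ) (a b : A), ∀ n, Connects (oneStepShift r) n a b →
      ∃ x ∈ oneStepShift r, x ∈ U ∧ shiftMap^[n + g] x ∈ V := by
  obtain ⟨x, hxU, hx⟩ := hUX
  obtain ⟨y, hyV, hy⟩ := hVX
  obtain ⟨M, hM⟩ := exists_cylinder_subset hU hxU
  obtain ⟨K, hK⟩ := exists_cylinder_subset hV hyV
  refine ⟨M + K, x M, y (-K), fun n hn => ?_⟩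
  obtain ⟨w, hw, hwx, hwy⟩ := hn
  obtain ⟨z, hz, hzx, hzw⟩ := exists_splice hx (shift_mem_oneStepShift hw (-M)) (k := M)
    (by simpa using hwx.symm)
  obtain ⟨v, hv, hvz, hvy⟩ := exists_splice hz (shift_mem_oneStepShift hy (-(n + M + K)))
    (k := M + n) (by
      rw [hzw _ (by omega)]
      convert hwy using 2 <;> ring)
  refine ⟨v, hv, hM v fun i _ hi => ?_, hK _ fun i hi _ => ?_⟩
  · rw [hvz i (by omega), hzx i hi]
  · rw [iterate_shiftMap_apply, hvy _ (by push_cast; omega)]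
    congr 1
    push_cast
    ring

theorem transitiveOn_oneStepShift [TopologicalSpace A]
    (h : ∀ a b, ∃ n, 0 < n ∧ Connects (oneStepShift r) n a b) :
    TransitiveOn (oneStepShift r) := by
  intro U V hU hV hUX hVX
  obtain ⟨g, a, b, hg⟩ := exists_gap_of_isOpen hU hV hUX hVX
  obtain ⟨n, hn, hab⟩ := h a b
  exact ⟨n + g, by omega, hg n hab⟩

theorem mixingOn_oneStepShift [TopologicalSpace A]
    (h : ∀ a b, ∃ M, ∀ n, M ≤ n → Connects (oneStepShift r) n a b) :
    MixingOn (oneStepShift r) := by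
  intro U V hU hV hUX hVX
  obtain ⟨g, a, b, hg⟩ := exists_gap_of_isOpen hU hV hUX hVX
  obtain ⟨M, hM⟩ := h a b
  refine ⟨M + g, fun n hn => ?_⟩
  obtain ⟨k, rfl⟩ := Nat.exists_eq_add_of_le' (show g ≤ n by omega)
  exact hg k (hM k (by omega))

end Splicing

section Relabelling

variable {A F : Type*} (e : A ≃ F) (r : A → A → Prop)

theorem comp_mem_oneStepShift_relabel {x : ℤ → A} (hx : x ∈ oneStepShift r) :
    e ∘ x ∈ oneStepShift fun a b => r (e.symm a) (e.symm b) := by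
  intro i
  simpa using hx i

theorem Connects.relabel {n : ℕ} {a b : F}
    (h : Connects (oneStepShift r) n (e.symm a) (e.symm b)) :
    Connects (oneStepShift fun a b => r (e.symm a) (e.symm b)) n a b := by
  obtain ⟨x, hx, ha, hb⟩ := h
  exact ⟨e ∘ x, comp_mem_oneStepShift_relabel e r hx, by simp [ha], by simp [hb]⟩

theorem iterate_shiftMap_comp {A F : Type*} (f : A → F) (n : ℕ) (x : ℤ → A) :
    shiftMap^[n] (f ∘ x) = f ∘ shiftMap^[n] x := by
  ext i
  simp [iterate_shiftMap_apply]

theorem LPSset_subset_of_injective {A F : Type*} {f : A → F} (hf : f.Injective)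
    {X : Set (ℤ → A)} {Y : Set (ℤ → F)} (hXY : ∀ x ∈ X, f ∘ x ∈ Y) : LPSset X ⊆ LPSset Y := by
  rintro n ⟨hn, x, hx, hper, hleast⟩
  refine ⟨hn, f ∘ x, hXY x hx, by rw [iterate_shiftMap_comp, hper], fun k hk hkn h => ?_⟩
  rw [iterate_shiftMap_comp] at h
  exact hleast k hk hkn (hf.comp_left h)

theorem LPSset_relabel :
    LPSset (oneStepShift fun a b => r (e.symm a) (e.symm b)) = LPSset (oneStepShift r) :=
  (LPSset_subset_of_injective e.symm.injective fun _ hx => hx).antisymm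
    (LPSset_subset_of_injective e.injective fun _ => comp_mem_oneStepShift_relabel e r)

end Relabelling

/-- Position `p.2` in a block of length `d * p.1`, where `p.1` runs over `B`. -/
abbrev BlockVertex (d : ℕ) (B : Finset ℕ) : Type :=
  {p : ℕ × ℕ // p.1 ∈ B ∧ p.2 < d * p.1}

/-- Advance inside a block, or pass from the end of a block to the start of another one;
two distinct consecutive blocks may not both have index less than `N`. -/
def BlockStep (d N : ℕ) (B : Finset ℕ) (u v : BlockVertex d B) : Prop :=
  (v.1.1 = u.1.1 ∧ v.1.2 = u.1.2 + 1) ∨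
    (u.1.2 + 1 = d * u.1.1 ∧ v.1.2 = 0 ∧ (u.1.1 = v.1.1 ∨ N ≤ u.1.1 ∨ N ≤ v.1.1))

section Blocks

variable {d N : ℕ} {B : Finset ℕ}

instance finite_blockVertex : Finite (BlockVertex d B) := by
  refine Set.Finite.subset (B.biUnion fun m => {m} ×ˢ Finset.range (d * m)).finite_toSet ?_
  rintro ⟨m, k⟩ ⟨hm, hk⟩
  simpa using ⟨hk, hm⟩

/-- The sequence of period `d * (q * N + m)` repeating the block of index `m` followed by `q`
blocks of index `N`. -/
def blockSeq (d N q m : ℕ) (i : ℤ) : ℕ × ℕ :=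
  let t := (i % (d * (q * N + m) : ℕ)).toNat
  if t < d * m then (m, t) else (N, (t - d * m) % (d * N))

theorem blockSeq_mem (hd : 0 < d) (hB : ∀ m ∈ B, 0 < m) (hN : N ∈ B) {m : ℕ} (hm : m ∈ B)
    (q : ℕ) (i : ℤ) :
    (blockSeq d N q m i).1 ∈ B ∧ (blockSeq d N q m i).2 < d * (blockSeq d N q m i).1 := by
  unfold blockSeq
  dsimp only
  split_ifs with h
  · exact ⟨hm, h⟩
  · exact ⟨hN, Nat.mod_lt _ (Nat.mul_pos hd (hB N hN))⟩

/-- `blockSeq` as a sequence of vertices. -/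
def blockPoint (hd : 0 < d) (hB : ∀ m ∈ B, 0 < m) (hN : N ∈ B) {m : ℕ} (hm : m ∈ B) (q : ℕ) :
    ℤ → BlockVertex d B :=
  fun i => ⟨blockSeq d N q m i, blockSeq_mem hd hB hN hm q i⟩

theorem blockSeq_add_period (q m : ℕ) (i : ℤ) :
    blockSeq d N q m (i + (d * (q * N + m) : ℕ)) = blockSeq d N q m i := by
  simp only [blockSeq, Int.add_emod_right]

theorem blockSeq_natCast {q m t : ℕ} (ht : t < d * (q * N + m)) :
    blockSeq d N q m t = if t < d * m then (m, t) else (N, (t - d * m) % (d * N)) := by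
  simp only [blockSeq, ← Int.natCast_mod, Nat.mod_eq_of_lt ht, Int.toNat_natCast]

theorem exists_natCast_blockSeq (hd : 0 < d) {q m : ℕ} (hm : 0 < m) (i : ℤ) :
    ∃ t < d * (q * N + m), blockSeq d N q m i = blockSeq d N q m t ∧
      blockSeq d N q m (i + 1) = blockSeq d N q m (t + 1) := by
  have hT : (0 : ℤ) < (d * (q * N + m) : ℕ) := by positivity
  have h0 := Int.emod_nonneg i hT.ne'
  have h1 := Int.emod_lt_of_pos i hT
  refine ⟨(i % (d * (q * N + m) : ℕ)).toNat, by omega, ?_, ?_⟩ <;>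
  · rw [Int.toNat_of_nonneg h0]
    simp only [blockSeq, Int.emod_emod_of_dvd, dvd_refl, Int.emod_add_emod]

theorem blockPoint_mem (hd : 0 < d) (hB : ∀ m ∈ B, 0 < m) (hN : N ∈ B) {m : ℕ} (hm : m ∈ B)
    (q : ℕ) : blockPoint hd hB hN hm q ∈ oneStepShift (BlockStep d N B) := by
  intro i
  obtain ⟨t, ht, h0, h1⟩ := exists_natCast_blockSeq (N := N) (q := q) hd (hB m hm) i
  have hN0 := Nat.mul_pos hd (hB N hN)
  have hm0 := Nat.mul_pos hd (hB m hm)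
  unfold BlockStep blockPoint
  dsimp only
  rw [h0, h1, blockSeq_natCast ht]
  have hT : d * (q * N + m) = d * N * q + d * m := by ring
  rcases Nat.lt_or_ge (t + 1) (d * (q * N + m)) with hlt | hge
  · rw [← Nat.cast_succ, blockSeq_natCast hlt]
    by_cases h2 : t + 1 < d * m
    · left
      simp [h2, show t < d * m by omega]
    · by_cases h3 : t < d * m
      · right
        simp only [h3, if_true, h2, if_false]
        simp [show t + 1 - d * m = 0 by omega]
        omega
      · simp only [h3, if_false, h2]
        rw [show t + 1 - d * m = (t - d * m) + 1 by omega]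
        have := Nat.mod_lt (t - d * m) hN0
        rw [← Nat.mod_add_mod]
        rcases Nat.lt_or_ge ((t - d * m) % (d * N) + 1) (d * N) with h4 | h4
        · left
          simp [Nat.mod_eq_of_lt h4]
        · right
          have h5 : (t - d * m) % (d * N) + 1 = d * N := by omega
          simp [h5]
  · have hte : t + 1 = d * (q * N + m) := by omega
    have h2 : blockSeq d N q m (t + 1) = (m, 0) := by
      have := blockSeq_add_period (d := d) (N := N) q m 0
      rw [zero_add, ← hte] at this
      push_cast at this
      rw [this]
      simp [blockSeq, hm0]
    rw [h2]
    right
    by_cases h3 : t < d * m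
    · simp only [h3, if_true]
      have := Nat.mul_le_mul_left d (Nat.le_add_left m (q * N))
      exact ⟨by omega, trivial, .inl trivial⟩
    · simp only [h3, if_false]
      refine ⟨?_, trivial, .inr (.inl le_rfl)⟩
      have h4 : ((t - d * m) % (d * N) + 1) % (d * N) = 0 := by
        rw [Nat.mod_add_mod, show t - d * m + 1 = d * N * q by omega, Nat.mul_mod_right]
      exact Nat.le_antisymm (Nat.mod_lt _ hN0)
        (Nat.le_of_dvd (Nat.succ_pos _) (Nat.dvd_of_mod_eq_zero h4))

theorem connects_to_hub (hd : 0 < d) (hB : ∀ m ∈ B, 0 < m) (hN : N ∈ B) (u : BlockVertex d B) :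
    ∃ n, 0 < n ∧ Connects (oneStepShift (BlockStep d N B)) n u
      ⟨(N, 0), hN, Nat.mul_pos hd (hB N hN)⟩ := by
  obtain ⟨⟨m, k⟩, hm, hk⟩ := u
  dsimp only at hm hk
  have hT : d * (1 * N + m) = d * N + d * m := by ring
  have hN0 := Nat.mul_pos hd (hB N hN)
  refine ⟨d * m - k, by omega, .of_mem (blockPoint_mem hd hB hN hm 1) (i := k) ?_ ?_⟩
  · refine Subtype.ext ?_
    simp only [blockPoint]
    rw [blockSeq_natCast (by omega)]
    simp [hk]
  · refine Subtype.ext ?_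
    simp only [blockPoint]
    rw [← Nat.cast_add, show k + (d * m - k) = d * m by omega, blockSeq_natCast (by omega)]
    simp

theorem connects_from_hub (hd : 0 < d) (hB : ∀ m ∈ B, 0 < m) (hN : N ∈ B) (u : BlockVertex d B) :
    ∃ n, Connects (oneStepShift (BlockStep d N B)) n
      ⟨(N, 0), hN, Nat.mul_pos hd (hB N hN)⟩ u := by
  obtain ⟨⟨m, k⟩, hm, hk⟩ := u
  dsimp only at hm hk
  have hT : d * (1 * N + m) = d * N + d * m := by ring
  have hN0 := Nat.mul_pos hd (hB N hN)
  refine ⟨d * N + k, .of_mem (blockPoint_mem hd hB hN hm 1) (i := (d * m : ℕ)) ?_ ?_⟩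
  · refine Subtype.ext ?_
    simp only [blockPoint]
    rw [blockSeq_natCast (by omega)]
    simp
  · refine Subtype.ext ?_
    simp only [blockPoint]
    rw [show ((d * m : ℕ) : ℤ) + (d * N + k : ℕ) = (k : ℤ) + (d * (1 * N + m) : ℕ) by
      rw [hT]; push_cast; ring, blockSeq_add_period, blockSeq_natCast (by omega)]
    simp [hk]

theorem connects_hub_hub (hd : 0 < d) (hB : ∀ m ∈ B, 0 < m) (hN : N ∈ B) {q m : ℕ} (hq : 0 < q)
    (hm : m ∈ B) :
    Connects (oneStepShift (BlockStep d N B)) (d * (q * N + m))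
      ⟨(N, 0), hN, Nat.mul_pos hd (hB N hN)⟩ ⟨(N, 0), hN, Nat.mul_pos hd (hB N hN)⟩ := by
  have key : blockSeq d N q m (d * m : ℕ) = (N, 0) := by
    have := hB N hN
    rw [blockSeq_natCast (Nat.mul_lt_mul_of_pos_left (by nlinarith) hd)]
    simp
  refine .of_mem (blockPoint_mem hd hB hN hm q) (i := (d * m : ℕ)) (Subtype.ext key)
    (Subtype.ext ?_)
  simp only [blockPoint]
  rw [blockSeq_add_period, key]

theorem connects_blockStep (hd : 0 < d) (hB : ∀ m ∈ B, 0 < m) (hN : N ∈ B)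
    (u v : BlockVertex d B) :
    ∃ n, 0 < n ∧ Connects (oneStepShift (BlockStep d N B)) n u v := by
  obtain ⟨a, ha, hu⟩ := connects_to_hub hd hB hN u
  obtain ⟨b, hv⟩ := connects_from_hub hd hB hN v
  exact ⟨a + b, by omega, hu.trans hv⟩

theorem eventually_connects_blockStep (hB : ∀ m ∈ B, 0 < m) (hN : N ∈ B)
    (hrep : ∃ M, ∀ n, M ≤ n → ∃ q m, 0 < q ∧ m ∈ B ∧ n = q * N + m) (u v : BlockVertex 1 B) :
    ∃ M, ∀ n, M ≤ n → Connects (oneStepShift (BlockStep 1 N B)) n u v := by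
  obtain ⟨a, -, hu⟩ := connects_to_hub one_pos hB hN u
  obtain ⟨b, hv⟩ := connects_from_hub one_pos hB hN v
  obtain ⟨M, hM⟩ := hrep
  refine ⟨a + M + b, fun n hn => ?_⟩
  obtain ⟨q, m, hq, hm, h⟩ := hM (n - a - b) (by omega)
  have := (hu.trans (connects_hub_hub one_pos hB hN hq hm)).trans hv
  rwa [one_mul, ← h, show a + (n - a - b) + b = n by omega] at this

theorem sub_of_mem_blockShift {x : ℤ → BlockVertex d B}
    (hx : x ∈ oneStepShift (BlockStep d N B)) {i : ℤ} {m k : ℕ} (hi : (x i).1 = (m, k)) (t : ℕ)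
    (ht : t ≤ k) : (x (i - t)).1 = (m, k - t) := by
  induction t with
  | zero => simpa using hi
  | succ t ih =>
    have ih := ih (by omega)
    have h := hx (i - (t + 1 : ℕ))
    rw [show i - (t + 1 : ℕ) + 1 = i - t by push_cast; ring, BlockStep, ih] at h
    dsimp only at h
    ext <;> dsimp only <;> omega

theorem add_of_mem_blockShift {x : ℤ → BlockVertex d B}
    (hx : x ∈ oneStepShift (BlockStep d N B)) {i : ℤ} {m k : ℕ} (hi : (x i).1 = (m, k)) (t : ℕ)
    (ht : k + t < d * m) : (x (i + t)).1 = (m, k + t) := by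
  induction t with
  | zero => simpa using hi
  | succ t ih =>
    have ih := ih (by omega)
    have h := hx (i + t)
    rw [show i + t + 1 = i + (t + 1 : ℕ) by push_cast; ring, BlockStep, ih] at h
    dsimp only at h
    ext <;> dsimp only <;> omega

theorem blockLength_le_of_periodic {x : ℤ → BlockVertex d B}
    (hx : x ∈ oneStepShift (BlockStep d N B)) {n : ℕ} (hn : 0 < n) (hper : shiftMap^[n] x = x)
    (i : ℤ) : d * (x i).1.1 ≤ n := by
  by_contra! hlt
  have hk := (x i).2.2
  generalize hxi : (x i).1 = p at hlt hk
  obtain ⟨m, k⟩ := p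
  dsimp only at hlt hk
  have h := add_of_mem_blockShift hx hxi (d * m - 1 - k) (by omega)
  have h' := sub_of_mem_blockShift hx h n (by omega)
  have hp := congrFun hper (i + (d * m - 1 - k : ℕ) - n)
  rw [iterate_shiftMap_apply, sub_add_cancel] at hp
  rw [← hp, h] at h'
  have := (Prod.ext_iff.1 h').2
  dsimp only at this
  omega

theorem modEq_of_mem_blockShift {x : ℤ → BlockVertex d B}
    (hx : x ∈ oneStepShift (BlockStep d N B)) {D : ℕ} (hD : ∀ i, D ∣ d * (x i).1.1) (i : ℤ)
    (n : ℕ) : (x (i + n)).1.2 ≡ (x i).1.2 + n [MOD D] := by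
  induction n with
  | zero => simp [Nat.ModEq.refl]
  | succ n ih =>
    have hstep : (x (i + n + 1)).1.2 ≡ (x (i + n)).1.2 + 1 [MOD D] := by
      rcases hx (i + n) with ⟨-, h⟩ | ⟨h, h', -⟩
      · rw [h]
      · rw [h, h']
        exact (Nat.modEq_zero_iff_dvd.2 (hD _)).symm
    have := hstep.trans (ih.add_right 1)
    rwa [add_assoc, add_assoc] at this

theorem dvd_of_periodic {x : ℤ → BlockVertex d B}
    (hx : x ∈ oneStepShift (BlockStep d N B)) {D : ℕ} (hD : ∀ i, D ∣ d * (x i).1.1) {n : ℕ}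
    (hper : shiftMap^[n] x = x) : D ∣ n := by
  have h := modEq_of_mem_blockShift hx hD 0 n
  have hp := congrFun hper 0
  rw [iterate_shiftMap_apply] at hp
  rw [hp] at h
  exact Nat.modEq_zero_iff_dvd.1 (Nat.ModEq.add_left_cancel' _ h.symm)

theorem periodic_of_constant_index {x : ℤ → BlockVertex d B}
    (hx : x ∈ oneStepShift (BlockStep d N B)) {s : ℕ} (hs : ∀ i, (x i).1.1 = s) :
    shiftMap^[d * s] x = x := by
  ext1 i
  rw [iterate_shiftMap_apply]
  refine Subtype.ext (Prod.ext (by rw [hs, hs]) ?_)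
  have h := modEq_of_mem_blockShift hx (D := d * s) (fun i => by rw [hs]) i (d * s)
  rw [Nat.ModEq, Nat.add_mod_right] at h
  have h1 := (x i).2.2
  have h2 := (x (i + (d * s : ℕ))).2.2
  rw [hs] at h1 h2
  rwa [Nat.mod_eq_of_lt h1, Nat.mod_eq_of_lt h2] at h

theorem LPSset_blockShift_subset (hB : ∀ m ∈ B, 0 < m) (hd : 0 < d) {S : Set ℕ}
    (hBS : ∀ m ∈ B, m ∈ S) (hS : (∀ t, N ≤ t → t ∈ S) ∨ ∀ m ∈ B, m = N) :
    LPSset (oneStepShift (BlockStep d N B)) ⊆ (fun s => d * s) '' S := by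
  rintro n ⟨hn, x, hx, hper, hleast⟩
  by_cases hconst : ∀ i, (x (i + 1)).1.1 = (x i).1.1
  · have hs : ∀ i, (x i).1.1 = (x 0).1.1 := by
      intro i
      induction i with
      | zero => rfl
      | succ i ih => rw [hconst, ih]
      | pred i ih => rw [← ih, ← hconst, sub_add_cancel]
    refine ⟨(x 0).1.1, hBS _ (x 0).2.1, ?_⟩
    have h0 : 0 < d * (x 0).1.1 := Nat.mul_pos hd (hB _ (x 0).2.1)
    refine (blockLength_le_of_periodic hx hn hper 0).antisymm ?_
    by_contra! hlt
    exact hleast _ h0 hlt (periodic_of_constant_index hx hs)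
  · push Not at hconst
    obtain ⟨i, hi⟩ := hconst
    obtain ⟨j, hj⟩ : ∃ j, N ≤ (x j).1.1 := by
      rcases hx i with ⟨h, -⟩ | ⟨-, -, h | h | h⟩
      · exact absurd h hi
      · exact absurd h.symm hi
      · exact ⟨i, h⟩
      · exact ⟨i + 1, h⟩
    obtain ⟨t, rfl⟩ := dvd_of_periodic hx (fun i => Nat.dvd_mul_right d _) hper
    rcases hS with hS | hS
    · have := Nat.le_of_mul_le_mul_left (blockLength_le_of_periodic hx hn hper j) hd
      exact ⟨t, hS t (hj.trans this), rfl⟩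
    · exact absurd ((hS _ (x (i + 1)).2.1).trans (hS _ (x i).2.1).symm) hi

theorem mem_LPSset_blockShift (hd : 0 < d) (hB : ∀ m ∈ B, 0 < m) (hN : N ∈ B) {q m : ℕ}
    (hm : m ∈ B) (hqm : q ≠ 0 → m ≠ N) :
    d * (q * N + m) ∈ LPSset (oneStepShift (BlockStep d N B)) := by
  have hm0 := hB m hm
  refine ⟨by positivity, blockPoint hd hB hN hm q, blockPoint_mem hd hB hN hm q, ?_, ?_⟩
  · ext1 i
    rw [iterate_shiftMap_apply]
    exact Subtype.ext (blockSeq_add_period q m i)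
  · intro k hk hlt h
    have h0 := congrArg Subtype.val (congrFun h 0)
    rw [iterate_shiftMap_apply, zero_add] at h0
    simp only [blockPoint] at h0
    rw [blockSeq_natCast hlt, ← Nat.cast_zero, blockSeq_natCast (by omega),
      if_pos (Nat.mul_pos hd hm0)] at h0
    split_ifs at h0 with h1
    · simp only [Prod.mk.injEq] at h0
      omega
    · refine hqm ?_ (Prod.ext_iff.1 h0).1.symm
      rintro rfl
      simp at hlt
      omega

theorem LPSset_blockShift (hd : 0 < d) (hB : ∀ m ∈ B, 0 < m) (hN : N ∈ B) {S : Set ℕ}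
    (hBS : ∀ m ∈ B, m ∈ S) (hS : (∀ t, N ≤ t → t ∈ S) ∨ ∀ m ∈ B, m = N)
    (hrep : ∀ s ∈ S, ∃ q m, m ∈ B ∧ s = q * N + m ∧ (q ≠ 0 → m ≠ N)) :
    LPSset (oneStepShift (BlockStep d N B)) = (fun s => d * s) '' S := by
  refine (LPSset_blockShift_subset hB hd hBS hS).antisymm ?_
  rintro _ ⟨s, hs, rfl⟩
  obtain ⟨q, m, hm, rfl, hqm⟩ := hrep s hs
  exact mem_LPSset_blockShift hd hB hN hm hqm

end Blocks

/-- The block shifts realize `d * S` as soon as `S` is generated by finitely many block indices. -/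
theorem exists_SFT_of_blocks {d N : ℕ} {B : Finset ℕ} {S : Set ℕ} (hd : 0 < d)
    (hB : ∀ m ∈ B, 0 < m) (hN : N ∈ B) (hBS : ∀ m ∈ B, m ∈ S)
    (hS : (∀ t, N ≤ t → t ∈ S) ∨ ∀ m ∈ B, m = N)
    (hrep : ∀ s ∈ S, ∃ q m, m ∈ B ∧ s = q * N + m ∧ (q ≠ 0 → m ≠ N))
    (hmix : ∃ M, ∀ n, M ≤ n → ∃ q m, 0 < q ∧ m ∈ B ∧ n = q * N + m) :
    ∃ (m : ℕ) (X : Set (ℤ → Fin m)), IsOneStepSFT X ∧ TransitiveOn X ∧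
      LPSset X = (fun s => d * s) '' S ∧ (d = 1 → MixingOn X) := by
  obtain ⟨n, ⟨e⟩⟩ := Finite.exists_equiv_fin (BlockVertex d B)
  refine ⟨n, oneStepShift fun a b => BlockStep d N B (e.symm a) (e.symm b),
    isOneStepSFT_oneStepShift _, transitiveOn_oneStepShift fun a b => ?_,
    (LPSset_relabel e _).trans (LPSset_blockShift hd hB hN hBS hS hrep), ?_⟩
  · obtain ⟨k, hk, h⟩ := connects_blockStep hd hB hN (e.symm a) (e.symm b)
    exact ⟨k, hk, h.relabel⟩
  · rintro rfl
    refine mixingOn_oneStepShift fun a b => ?_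
    obtain ⟨M, h⟩ := eventually_connects_blockStep hB hN hmix (e.symm a) (e.symm b)
    exact ⟨M, fun k hk => (h k hk).relabel⟩

theorem exists_SFT_singleton {d : ℕ} (hd : 0 < d) :
    ∃ (m : ℕ) (X : Set (ℤ → Fin m)), IsOneStepSFT X ∧ TransitiveOn X ∧
      LPSset X = {d} ∧ (d = 1 → MixingOn X) := by
  have := exists_SFT_of_blocks (d := d) (N := 1) (B := {1}) (S := {1}) hd (by simp) (by simp)
    (by simp) (by simp) (fun s hs => ⟨0, 1, by simp, by simpa using hs, by simp⟩)
    ⟨2, fun n hn => ⟨n - 1, 1, by omega, by simp, by omega⟩⟩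
  simpa using this

theorem CofinitePos.exists_forall_mem {S : Set ℕ} (hS : CofinitePos S) :
    ∃ N, 0 < N ∧ ∀ t, N ≤ t → t ∈ S := by
  obtain ⟨b, hb⟩ := hS.2.bddAbove
  refine ⟨b + 1, by omega, fun t ht => ?_⟩
  by_contra h
  have := hb ⟨show 0 < t by omega, h⟩
  omega

theorem exists_SFT_of_cofinitePos {d : ℕ} (hd : 0 < d) {S : Set ℕ} (hS : CofinitePos S) :
    ∃ (m : ℕ) (X : Set (ℤ → Fin m)), IsOneStepSFT X ∧ TransitiveOn X ∧
      LPSset X = (fun s => d * s) '' S ∧ (d = 1 → MixingOn X) := by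
  classical
  obtain ⟨N, hN0, hN⟩ := hS.exists_forall_mem
  have hmem : ∀ m, m ∈ (Finset.range (2 * N + 1)).filter (· ∈ S) ↔ m ≤ 2 * N ∧ m ∈ S := by
    intro m
    rw [Finset.mem_filter, Finset.mem_range, Nat.lt_succ_iff]
  have key : ∀ n, 2 * N < n → ∃ q m, 0 < q ∧ m ∈ (Finset.range (2 * N + 1)).filter (· ∈ S) ∧
      n = q * N + m ∧ m ≠ N := by
    intro n hn
    have h1 := Nat.mod_lt (n - N - 1) hN0
    have h2 := Nat.div_add_mod' (n - N - 1) N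
    refine ⟨(n - N - 1) / N, N + 1 + (n - N - 1) % N, Nat.div_pos (by omega) hN0,
      (hmem _).2 ⟨by omega, hN _ (by omega)⟩, by omega, by omega⟩
  refine exists_SFT_of_blocks (N := N) (B := (Finset.range (2 * N + 1)).filter (· ∈ S)) hd
    (fun m hm => hS.1 ((hmem m).1 hm).2) ((hmem N).2 ⟨by omega, hN N le_rfl⟩)
    (fun m hm => ((hmem m).1 hm).2) (.inl hN) (fun s hs => ?_) ⟨2 * N + 1, fun n hn => ?_⟩
  · rcases Nat.lt_or_ge (2 * N) s with h | h
    · obtain ⟨q, m, -, hm, hs', hmN⟩ := key s h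
      exact ⟨q, m, hm, hs', fun _ => hmN⟩
    · exact ⟨0, s, (hmem s).2 ⟨h, hs⟩, by simp, by simp⟩
  · obtain ⟨q, m, hq, hm, hs', -⟩ := key n hn
    exact ⟨q, m, hq, hm, hs'⟩

/-- Every set `R` which is a singleton `{d}` or of the form `dS` with `S` cofinite is the
least period set of some irreducible one-step SFT; moreover if `R = {1}` or `R` is
cofinite, the SFT can be taken to be mixing. -/
theorem realize_LPS_by_irreducible_SFT (R : Set ℕ)
    (hR : (∃ d : ℕ, 0 < d ∧ R = {d}) ∨
      (∃ (d : ℕ) (S : Set ℕ), 0 < d ∧ CofinitePos S ∧ R = (fun s => d * s) '' S)) :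
    (∃ (m : ℕ) (X : Set (ℤ → Fin m)), IsOneStepSFT X ∧ TransitiveOn X ∧ LPSset X = R) ∧
    ((R = {1} ∨ CofinitePos R) →
      ∃ (m : ℕ) (X : Set (ℤ → Fin m)), IsOneStepSFT X ∧ MixingOn X ∧ LPSset X = R) := by
  refine ⟨?_, ?_⟩
  · rcases hR with ⟨d, hd, rfl⟩ | ⟨d, S, hd, hS, rfl⟩
    · obtain ⟨m, X, h₁, h₂, h₃, -⟩ := exists_SFT_singleton hd
      exact ⟨m, X, h₁, h₂, h₃⟩
    · obtain ⟨m, X, h₁, h₂, h₃, -⟩ := exists_SFT_of_cofinitePos hd hS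
      exact ⟨m, X, h₁, h₂, h₃⟩
  · rintro (rfl | hS)
    · obtain ⟨m, X, h₁, -, h₃, h₄⟩ := exists_SFT_singleton one_pos
      exact ⟨m, X, h₁, h₄ rfl, h₃⟩
    · obtain ⟨m, X, h₁, -, h₃, h₄⟩ := exists_SFT_of_cofinitePos one_pos hS
      exact ⟨m, X, h₁, h₄ rfl, by simpa using h₃⟩
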